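/- For any ideal I of k[x_1,...,x_n] and any variable y, the ideal in_y(I) generated by all initial y-forms of elements of I is contained in C_{y,I} ∩ (N_{y,I} + ⟨y⟩), where C_{y,I} and N_{y,I} are computed from a Gröbner basis of I with respect to a y-compatible order. -/

import Mathlib

open MvPolynomial

noncomputable section

/-- The initial `y`-form of a polynomial: if `f = ∑ αᵢ yⁱ` with the `αᵢ` not involving `y`,
then `inyForm y f = α_d y^d` where `d` is maximal with `α_d ≠ 0`. -/
def inyForm {k : Type} [Field k] {n : ℕ} (y : Fin n) (f : MvPolynomial (Fin n) k) :
    MvPolynomial (Fin n) k :=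
  ∑ m ∈ f.support.filter (fun m => m y = f.degreeOf y), monomial m (f.coeff m)

/-- The ideal generated by all initial `y`-forms of elements of `I`. -/
def inyIdeal {k : Type} [Field k] {n : ℕ} (y : Fin n) (I : Ideal (MvPolynomial (Fin n) k)) :
    Ideal (MvPolynomial (Fin n) k) :=
  Ideal.span { p | ∃ f ∈ I, p = inyForm y f }

/-- For `g = q y^d + r` with `in_y(g) = q y^d` and `y` not dividing any term of `q`,
`qPart y g` is the polynomial `q`. -/
def qPart {k : Type} [Field k] {n : ℕ} (y : Fin n) (g : MvPolynomial (Fin n) k) :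
    MvPolynomial (Fin n) k :=
  ∑ m ∈ g.support.filter (fun m => m y = g.degreeOf y),
    monomial (m - Finsupp.single y (g.degreeOf y)) (g.coeff m)

/-- The ideal `C_{y,I}` computed from a (Gröbner) generating set `G`. -/
def CIdeal {k : Type} [Field k] {n : ℕ} (y : Fin n) (G : Finset (MvPolynomial (Fin n) k)) :
    Ideal (MvPolynomial (Fin n) k) :=
  Ideal.span (qPart y '' (G : Set (MvPolynomial (Fin n) k)))

/-- The ideal `N_{y,I}` computed from a (Gröbner) generating set `G`:
generated by those `q_i` with `d_i = 0`. -/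
def NIdeal {k : Type} [Field k] {n : ℕ} (y : Fin n) (G : Finset (MvPolynomial (Fin n) k)) :
    Ideal (MvPolynomial (Fin n) k) :=
  Ideal.span (qPart y '' { g | g ∈ G ∧ g.degreeOf y = 0 })

/-- `μ` is the leading monomial of `f` with respect to the monomial order `m`. -/
def LeadMonomialIs {k : Type} [Field k] {n : ℕ} (m : MonomialOrder (Fin n))
    (f : MvPolynomial (Fin n) k) (μ : Fin n →₀ ℕ) : Prop :=
  μ ∈ f.support ∧ ∀ ν ∈ f.support, m.toSyn ν ≤ m.toSyn μ

/-- `t` is the initial term `in_<(f)` of `f` with respect to the monomial order `m`. -/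
def InitialTermIs {k : Type} [Field k] {n : ℕ} (m : MonomialOrder (Fin n))
    (f t : MvPolynomial (Fin n) k) : Prop :=
  ∃ μ, LeadMonomialIs m f μ ∧ t = monomial μ (f.coeff μ)

/-- A monomial order `m` is `y`-compatible if `in_<(f) = in_<(in_y(f))` for all `f`. -/
def YCompatible (k : Type) [Field k] {n : ℕ} (m : MonomialOrder (Fin n)) (y : Fin n) : Prop :=
  ∀ f : MvPolynomial (Fin n) k, f ≠ 0 →
    ∀ t, InitialTermIs m f t ↔ InitialTermIs m (inyForm y f) t

/-- `G` is a Gröbner basis of `I` with respect to the monomial order `m`: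
`G ⊆ I` and the leading monomial of every nonzero element of `I` is divisible by the
leading monomial of some element of `G`. -/
def IsGB {k : Type} [Field k] {n : ℕ} (m : MonomialOrder (Fin n))
    (I : Ideal (MvPolynomial (Fin n) k)) (G : Finset (MvPolynomial (Fin n) k)) : Prop :=
  (G : Set (MvPolynomial (Fin n) k)) ⊆ I ∧ (0 : MvPolynomial (Fin n) k) ∉ G ∧
    ∀ f ∈ I, f ≠ 0 → ∃ g ∈ G, ∃ μ ν, LeadMonomialIs m g μ ∧ LeadMonomialIs m f ν ∧ μ ≤ ν

/-- The part of `f` of degree `d` in the variable `y`. -/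
def yComp {k : Type} [Field k] {n : ℕ} (y : Fin n) (d : ℕ) (f : MvPolynomial (Fin n) k) :
    MvPolynomial (Fin n) k :=
  ∑ m ∈ f.support.filter (fun m => m y = d), monomial m (f.coeff m)

lemma coeff_yComp {k : Type} [Field k] {n : ℕ} (y : Fin n) (d : ℕ)
    (f : MvPolynomial (Fin n) k) (μ : Fin n →₀ ℕ) :
    (yComp y d f).coeff μ = if μ y = d then f.coeff μ else 0 := by
  classical
  simp only [yComp, coeff_sum, coeff_monomial, Finset.sum_ite_eq', Finset.mem_filter,
    mem_support_iff]
  by_cases h : μ y = d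
  · by_cases h2 : coeff μ f = 0 <;> simp [h, h2]
  · simp [h]

lemma inyForm_eq_yComp {k : Type} [Field k] {n : ℕ} (y : Fin n)
    (f : MvPolynomial (Fin n) k) : inyForm y f = yComp y (f.degreeOf y) f := rfl

lemma inyForm_eq_qPart_mul {k : Type} [Field k] {n : ℕ} (y : Fin n)
    (f : MvPolynomial (Fin n) k) : inyForm y f = qPart y f * X y ^ (f.degreeOf y) := by
  rw [inyForm, qPart, Finset.sum_mul]
  refine Finset.sum_congr rfl fun μ hμ => ?_
  rw [X_pow_eq_monomial, monomial_mul, mul_one, tsub_add_cancel_of_le]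
  rw [Finsupp.single_le_iff]
  exact (Finset.mem_filter.1 hμ).2.ge

lemma le_degreeOf_of_mem {k : Type} [Field k] {n : ℕ} (y : Fin n)
    (f : MvPolynomial (Fin n) k) (μ : Fin n →₀ ℕ) (h : μ ∈ f.support) : μ y ≤ f.degreeOf y :=
  monomial_le_degreeOf y h

lemma lead_y {k : Type} [Field k] {n : ℕ} (m : MonomialOrder (Fin n)) (y : Fin n)
    (hyc : YCompatible k m y) (f : MvPolynomial (Fin n) k) (μ : Fin n →₀ ℕ)
    (h : LeadMonomialIs m f μ) : μ y = f.degreeOf y := by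
  have hc : f.coeff μ ≠ 0 := mem_support_iff.1 h.1
  have hf : f ≠ 0 := by rintro rfl; simp at hc
  obtain ⟨μ', h', e⟩ := (hyc f hf (monomial μ (f.coeff μ))).1 ⟨μ, h, rfl⟩
  have e2 : μ' = μ := by
    by_contra hne
    have := congrArg (coeff μ) e
    simp [coeff_monomial, hne, hc] at this
  subst e2
  have := mem_support_iff.1 h'.1
  rw [inyForm_eq_yComp, coeff_yComp] at this
  by_contra hne
  simp [hne] at this

lemma yComp_mem {k : Type} [Field k] {n : ℕ}
    (m : MonomialOrder (Fin n)) (y : Fin n) (hyc : YCompatible k m y)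
    (I : Ideal (MvPolynomial (Fin n) k)) (G : Finset (MvPolynomial (Fin n) k))
    (hGB : IsGB m I G) (J : Ideal (MvPolynomial (Fin n) k))
    (hJ : ∀ g ∈ G, inyForm y g ∈ J) (s : m.syn) :
    ∀ f ∈ I, (∀ ν ∈ f.support, m.toSyn ν ≤ s) → ∀ d, (∀ ν ∈ f.support, ν y ≤ d) →
      yComp y d f ∈ J := by
  induction s using WellFoundedLT.induction with
  | ind s ih =>
  intro f hf hs d hd
  by_cases h0 : ∃ ν ∈ f.support, ν y = d
  swap
  · have : yComp y d f = 0 := by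
      ext μ
      rw [coeff_yComp, coeff_zero]
      split_ifs with h
      · by_contra hne
        exact h0 ⟨μ, mem_support_iff.2 hne, h⟩
      · rfl
    rw [this]; exact J.zero_mem
  obtain ⟨κ, hκ, hκd⟩ := h0
  have hf0 : f ≠ 0 := by rintro rfl; simp at hκ
  obtain ⟨g, hg, μ, ν, hμ, hν, hle⟩ := hGB.2.2 f hf hf0
  have hμy := lead_y m y hyc g μ hμ
  have hνy : ν y = d := by
    have h1 := lead_y m y hyc f ν hν
    have h2 := le_degreeOf_of_mem y f κ hκ
    have h3 := hd ν hν.1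
    omega
  obtain ⟨a, rfl⟩ := exists_add_of_le hle
  have hgc : g.coeff μ ≠ 0 := mem_support_iff.1 hμ.1
  set c : k := f.coeff (μ + a) / g.coeff μ with hc
  set p := monomial a c * g with hp
  have hpc : ∀ lam, p.coeff lam ≠ 0 → ∃ κ ∈ g.support, lam = a + κ := by
    intro lam hlam
    rw [hp, coeff_monomial_mul'] at hlam
    split_ifs at hlam with h
    · exact ⟨lam - a, mem_support_iff.2 (right_ne_zero_of_mul hlam),
        (add_tsub_cancel_of_le h).symm⟩
    · exact absurd rfl hlam
  have hpν : p.coeff (μ + a) = f.coeff (μ + a) := by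
    rw [hp, add_comm μ a, coeff_monomial_mul, hc, add_comm a μ, div_mul_cancel₀ _ hgc]
  have hpJ : yComp y d p = monomial a c * inyForm y g := by
    ext lam
    rw [coeff_yComp, hp, coeff_monomial_mul', coeff_monomial_mul', inyForm_eq_yComp]
    by_cases h : a ≤ lam
    · obtain ⟨b, rfl⟩ := exists_add_of_le h
      rw [if_pos h, if_pos h, add_tsub_cancel_left, coeff_yComp]
      have : (a + b) y = d ↔ b y = g.degreeOf y := by
        rw [← hνy, ← hμy]; simp only [Finsupp.add_apply]; omega
      by_cases hb : b y = g.degreeOf y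
      · rw [if_pos (this.2 hb), if_pos hb]
      · rw [if_neg (fun h => hb (this.1 h)), if_neg hb, mul_zero]
    · simp [h]
  have hsplit : yComp y d f = yComp y d (f - p) + yComp y d p := by
    ext lam
    simp only [coeff_add, coeff_yComp, coeff_sub]
    split_ifs <;> ring
  have hsupp : ∀ lam ∈ (f - p).support, lam ∈ f.support ∨ ∃ κ ∈ g.support, lam = a + κ := by
    intro lam hlam
    by_cases h : p.coeff lam = 0
    · left
      rw [mem_support_iff, coeff_sub, h, sub_zero] at hlam
      exact mem_support_iff.2 hlam
    · exact Or.inr (hpc lam h)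
  have hlt : ∀ lam ∈ (f - p).support, m.toSyn lam < m.toSyn (μ + a) := by
    intro lam hlam
    refine lt_of_le_of_ne ?_ ?_
    · rcases hsupp lam hlam with h | ⟨κ, hκ, rfl⟩
      · exact hν.2 lam h
      · rw [add_comm a κ, map_add, map_add]
        exact add_le_add_left (hμ.2 κ hκ) _
    · intro he
      have := m.toSyn.injective he
      subst this
      rw [mem_support_iff, coeff_sub, hpν, sub_self] at hlam
      exact hlam rfl
  have hfp : f - p ∈ I := I.sub_mem hf (I.mul_mem_left _ (hGB.1 hg))
  rw [hsplit]
  refine J.add_mem ?_ (hpJ ▸ J.mul_mem_left _ (hJ g hg))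
  by_cases hz : f - p = 0
  · rw [hz]
    have : yComp y d (0 : MvPolynomial (Fin n) k) = 0 := by simp [yComp]
    rw [this]; exact J.zero_mem
  refine ih (m.toSyn (m.degree (f - p))) ?_ (f - p) hfp (fun ν hν => m.le_degree hν) d ?_
  · exact lt_of_lt_of_le (hlt _ (m.degree_mem_support hz)) (hs _ hν.1)
  · intro lam hlam
    rcases hsupp lam hlam with h | ⟨κ, hκ, rfl⟩
    · exact hd lam h
    · have := le_degreeOf_of_mem y g κ hκ
      simp only [Finsupp.add_apply] at hνy ⊢
      omega

/-- for any ideal `I` and variable `y`, with `C_{y,I}` and `N_{y,I}` computed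
from a Gröbner basis of `I` with respect to a `y`-compatible order,
`in_y(I) ⊆ C_{y,I} ∩ (N_{y,I} + ⟨y⟩)`. -/
theorem inyIdeal_le_CIdeal_inf_NIdeal_sup {k : Type} [Field k] {n : ℕ}
    (m : MonomialOrder (Fin n)) (y : Fin n) (hyc : YCompatible k m y)
    (I : Ideal (MvPolynomial (Fin n) k)) (G : Finset (MvPolynomial (Fin n) k))
    (hGB : IsGB m I G) :
    inyIdeal y I ≤ CIdeal y G ⊓ (NIdeal y G + Ideal.span {MvPolynomial.X y}) := by
  have key : ∀ J : Ideal (MvPolynomial (Fin n) k), (∀ g ∈ G, inyForm y g ∈ J) →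
      inyIdeal y I ≤ J := by
    intro J hJ
    refine Ideal.span_le.2 ?_
    rintro _ ⟨f, hf, rfl⟩
    exact yComp_mem m y hyc I G hGB J hJ _ f hf (fun ν hν => m.le_degree hν) _
      (fun ν hν => le_degreeOf_of_mem y f ν hν)
  refine key _ fun g hg => Ideal.mem_inf.2 ⟨?_, ?_⟩
  · rw [inyForm_eq_qPart_mul]
    exact Ideal.mul_mem_right _ _ (Ideal.subset_span ⟨g, hg, rfl⟩)
  · rw [inyForm_eq_qPart_mul, Submodule.add_eq_sup]
    by_cases h : g.degreeOf y = 0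
    · have h1 : qPart y g ∈ NIdeal y G := Ideal.subset_span ⟨g, ⟨hg, h⟩, rfl⟩
      exact Ideal.mul_mem_right _ _ (Ideal.mem_sup_left h1)
    · have h1 : (X y : MvPolynomial (Fin n) k) ∈ Ideal.span {(X y : MvPolynomial (Fin n) k)} :=
        Ideal.mem_span_singleton_self _
      have h2 := Ideal.pow_mem_of_mem _ h1 _ (Nat.pos_of_ne_zero h)
      exact Ideal.mul_mem_left _ _ (Ideal.mem_sup_right h2)

end
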